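/- For all Dyck paths a and s of the same length with a ≤ s, V(uad, usd) = Σ_{w ∈ [a, a*]} V(w, s), where the sum is over all Dyck paths w in the interval [a, a*] of the lattice of binary paths. -/

import Mathlib

/-- A binary path is a list of steps: `true` = upstep `u`, `false` = downstep `d`. -/
abbrev BinPath := List Bool

/-- `ht P k` is the height of the `k`-th point of the path `P` (the point reached
after the first `k` steps). -/
def ht (P : BinPath) (k : ℕ) : ℤ :=
  ((P.take k).map (fun b => if b then (1 : ℤ) else -1)).sum

/-- The lattice order on binary paths of the same length: `P ≤ Q` iff
`hᵢ(P) ≤ hᵢ(Q)` for all `i`. -/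
def pathLe (P Q : BinPath) : Prop :=
  P.length = Q.length ∧ ∀ k, ht P k ≤ ht Q k

def pathLt (P Q : BinPath) : Prop := pathLe P Q ∧ P ≠ Q

/-- The maximum path `1ₙ = uⁿ`. -/
def maxPath (n : ℕ) : BinPath := List.replicate n true

/-- Step `i` (0-based) of `P` is a downstep whose endpoint is a valley, i.e. it is
followed by an upstep or it is the last step of `P`. -/
def isValley (P : BinPath) (i : ℕ) : Prop :=
  i < P.length ∧ P.getD i true = false ∧ P.getD (i + 1) true = true

/-- The number of valleys of `P`. -/
def numValleys (P : BinPath) : ℕ :=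
  ((Finset.range P.length).filter
    (fun i => P.getD i true = false ∧ P.getD (i + 1) true = true)).card

/-- The filling of `P`: every valley of `P` is turned into a peak
(each occurrence `du` whose middle point is a valley becomes `ud`, and a final
valley-`d` becomes `u`). -/
def fill (P : BinPath) : BinPath :=
  List.ofFn (fun i : Fin P.length =>
    if P.get i then P.getD (i.1 - 1) true else P.getD (i.1 + 1) true)

/-- The degree of `P`: the least `k` such that the `k`-fold iterated filling
of `P` is the maximum path. -/
noncomputable def degree (P : BinPath) : ℕ :=
  sInf {k | fill^[k] P = maxPath P.length}

/-- `fPath P` is the number of chains from `P` to the maximum path `1_{|P|}` of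
length `degree P` having small intervals. -/
noncomputable def fPath (P : BinPath) : ℕ :=
  Set.ncard {c : ℕ → BinPath |
    c 0 = P ∧ (∀ i, degree P ≤ i → c i = maxPath P.length) ∧
    ∀ i < degree P, pathLt (c i) (c (i + 1)) ∧ pathLe (c (i + 1)) (fill (c i))}

/-- Height of the lowest valley of `P`. -/
noncomputable def lv (P : BinPath) : ℤ :=
  sInf {h : ℤ | ∃ i, isValley P i ∧ ht P (i + 1) = h}

/-- Height of the highest valley of `P`. -/
noncomputable def hv (P : BinPath) : ℤ :=
  sSup {h : ℤ | ∃ i, isValley P i ∧ ht P (i + 1) = h}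

noncomputable def hvNat (P : BinPath) : ℕ := (hv P).toNat

/-- `P′`: every low valley of `P` is turned into a peak. -/
noncomputable def lowFill (P : BinPath) : BinPath :=
  List.ofFn (fun i : Fin P.length =>
    if P.get i then
      (if P.getD (i.1 - 1) true = false ∧ ht P i.1 = lv P then false else true)
    else
      (if P.getD (i.1 + 1) true = true ∧ ht P (i.1 + 1) = lv P then true else false))

/-- `P*`: every valley of `P` is turned into a peak, except the last one when `P`
ends with a downstep. -/
def starFill (P : BinPath) : BinPath :=
  List.ofFn (fun i : Fin P.length =>
    if i.1 + 1 = P.length ∧ P.get i = false then false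
    else if P.get i then P.getD (i.1 - 1) true else P.getD (i.1 + 1) true)

/-- A Dyck path: starts and ends at height 0 and lies weakly above height 0. -/
def IsDyck (P : BinPath) : Prop := ht P P.length = 0 ∧ ∀ k, 0 ≤ ht P k

/-- A Dyck prefix: a prefix of a Dyck path. -/
def IsDyckPrefix (P : BinPath) : Prop := ∃ Q : BinPath, IsDyck (P ++ Q)

/-- A Dyck suffix: a suffix of a Dyck path. -/
def IsDyckSuffix (P : BinPath) : Prop := ∃ Q : BinPath, IsDyck (Q ++ P)

/-- The pyramid `u^m d^m`. -/
def pyramid (m : ℕ) : BinPath := List.replicate m true ++ List.replicate m false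

/-- Cardinality of the interval `[P, Q]` in the lattice of binary paths. -/
noncomputable def intervalCard (P Q : BinPath) : ℕ :=
  Set.ncard {R : BinPath | pathLe P R ∧ pathLe R Q}

/-- `I(s) = |[s, u^{|s|/2} d^{|s|/2}]|`. -/
noncomputable def Ifun (s : BinPath) : ℕ := intervalCard s (pyramid (s.length / 2))

/-- `J(P) = |[P, u^{|P|}]|`. -/
noncomputable def Jfun (P : BinPath) : ℕ := intervalCard P (maxPath P.length)

/-- `P` and `Q` have exactly the same valleys at every height at most `m`. -/
def sameValleysUpTo (P Q : BinPath) (m : ℤ) : Prop :=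
  ∀ (i : ℕ) (t : ℤ), t ≤ m →
    ((isValley P i ∧ ht P (i + 1) = t) ↔ (isValley Q i ∧ ht Q (i + 1) = t))

/-- A multichain of Dyck paths of type `V` from `a` to `s`: it has length
`h = hv(a)` and for every `j ∈ [h]` its `(j-1)`-st and `j`-th members have the
same valleys at every height at most `h - j`.  (The function `σ` is frozen from
index `h` on, so that such multichains are counted correctly.) -/
def IsVChain (a s : BinPath) (σ : ℕ → BinPath) : Prop :=
  σ 0 = a ∧ (∀ j, hvNat a ≤ j → σ j = s) ∧ (∀ j, IsDyck (σ j)) ∧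
  (∀ j < hvNat a, pathLe (σ j) (σ (j + 1))) ∧
  (∀ j, 1 ≤ j → j ≤ hvNat a →
    sameValleysUpTo (σ (j - 1)) (σ j) ((hvNat a : ℤ) - (j : ℤ)))

/-- `V(a,s)`: the number of `a`–`s` multichains of type `V`. -/
noncomputable def VPath (a s : BinPath) : ℕ :=
  Set.ncard {σ : ℕ → BinPath | IsVChain a s σ}

/-- `ζ^k(P,Q)`: the number of `P`–`Q` multichains of length `k`. -/
noncomputable def zetaPow (k : ℕ) (P Q : BinPath) : ℕ :=
  Set.ncard {c : ℕ → BinPath |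
    c 0 = P ∧ (∀ i, k ≤ i → c i = Q) ∧ ∀ i < k, pathLe (c i) (c (i + 1))}

/-- The join of two paths of the same length (pointwise max of heights). -/
def pathSup (P Q : BinPath) : BinPath :=
  List.ofFn (fun i : Fin P.length =>
    decide (max (ht P i.1) (ht Q i.1) < max (ht P (i.1 + 1)) (ht Q (i.1 + 1))))

/-- The meet of two paths of the same length (pointwise min of heights). -/
def pathInf (P Q : BinPath) : BinPath :=
  List.ofFn (fun i : Fin P.length =>
    decide (min (ht P i.1) (ht Q i.1) < min (ht P (i.1 + 1)) (ht Q (i.1 + 1))))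

/-- `Q` covers `P` in the lattice of binary paths. -/
def pathCovBy (P Q : BinPath) : Prop :=
  pathLt P Q ∧ ∀ R : BinPath, pathLt P R → pathLt R Q → False

/-- `l(P,Q) = (1/2)·Σᵢ (hᵢ(Q) − hᵢ(P))`. -/
def lpq (P Q : BinPath) : ℕ :=
  ((∑ i ∈ Finset.range P.length, (ht Q (i + 1) - ht P (i + 1))) / 2).toNat

/-- Convolution in the incidence algebra of the lattice of binary paths. -/
noncomputable def conv (F G : BinPath → BinPath → ℤ) : BinPath → BinPath → ℤ :=
  fun P Q => ∑ᶠ (R : BinPath) (_ : pathLe P R ∧ pathLe R Q), F P R * G R Q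

/-- The delta function of the incidence algebra. -/
def deltaFun : BinPath → BinPath → ℤ := fun P Q => if P = Q then 1 else 0

/-- `μ^k`: the `k`-th convolution power of `μ` (`μ^0` is the delta function). -/
noncomputable def muPow (mu : BinPath → BinPath → ℤ) (k : ℕ) : BinPath → BinPath → ℤ :=
  (conv mu)^[k] deltaFun

/-- `f` is the height function of a Dyck path of length `n`, extended by zero. -/
structure DyckHt (n : ℕ) (f : ℕ → ℤ) : Prop where
  zero : f 0 = 0
  step : ∀ k < n, f (k + 1) = f k + 1 ∨ f (k + 1) = f k - 1
  tail : ∀ k, n ≤ k → f k = 0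
  nonneg : ∀ k, 0 ≤ f k

/-- The `k`-th point of the path with height function `f` is an interior valley. -/
def InnerValley (n : ℕ) (f : ℕ → ℤ) (k : ℕ) : Prop :=
  0 < k ∧ k < n ∧ f (k - 1) = f k + 1 ∧ f (k + 1) = f k + 1

/-- The path of length `n` with height function `f`. -/
def ofHt (n : ℕ) (f : ℕ → ℤ) : BinPath :=
  List.ofFn (fun i : Fin n => decide (f i.1 < f (i.1 + 1)))

theorem ht_zero (P : BinPath) : ht P 0 = 0 := by simp [ht]

theorem ht_succ (P : BinPath) (k : ℕ) (hk : k < P.length) :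
    ht P (k + 1) = ht P k + (if P.getD k true then 1 else -1) := by
  unfold ht
  rw [List.take_add_one, List.map_append, List.sum_append, List.getElem?_eq_getElem hk]
  simp [List.getD, List.getElem?_eq_getElem hk]

theorem ht_of_length_le (P : BinPath) (k : ℕ) (hk : P.length ≤ k) :
    ht P k = ht P P.length := by
  unfold ht
  rw [List.take_of_length_le hk, List.take_length]

theorem isDyck_iff (P : BinPath) : IsDyck P ↔ DyckHt P.length (ht P) := by
  constructor
  · rintro ⟨h0, h1⟩
    refine ⟨ht_zero P, fun k hk => ?_, fun k hk => ?_, h1⟩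
    · rw [ht_succ P k hk]
      split_ifs <;> omega
    · rw [ht_of_length_le P k hk, h0]
  · rintro ⟨-, -, h2, h3⟩
    exact ⟨h2 _ le_rfl, h3⟩

theorem length_ofHt (n : ℕ) (f : ℕ → ℤ) : (ofHt n f).length = n := by simp [ofHt]

theorem ht_ofHt {n : ℕ} {f : ℕ → ℤ} (hf : DyckHt n f) : ht (ofHt n f) = f := by
  have key : ∀ k ≤ n, ht (ofHt n f) k = f k := by
    intro k
    induction k with
    | zero => intro _; rw [ht_zero, hf.zero]
    | succ k ih =>
      intro hk
      rw [ht_succ _ _ (by rw [length_ofHt]; omega), ih (by omega)]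
      have hg : (ofHt n f).getD k true = decide (f k < f (k + 1)) := by
        have : k < n := by omega
        simp [ofHt, List.getD, this]
      rw [hg]
      have h := hf.step k (by omega)
      simp only [decide_eq_true_eq]
      split_ifs <;> omega
  funext k
  rcases le_total k n with h | h
  · exact key k h
  · rw [ht_of_length_le _ _ (by rwa [length_ofHt]), length_ofHt, key n le_rfl,
      hf.tail k h, hf.tail n le_rfl]

theorem eq_of_ht_eq {P Q : BinPath} (hl : P.length = Q.length) (h : ht P = ht Q) : P = Q := by
  refine List.ext_getElem hl fun k hk hk' => ?_
  have h1 := ht_succ P k hk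
  have h2 := ht_succ Q k hk'
  rw [h, h2] at h1
  simp only [List.getD, List.getElem?_eq_getElem hk, List.getElem?_eq_getElem hk',
    Option.getD_some] at h1
  cases hP : P[k] <;> cases hQ : Q[k] <;> simp_all

theorem isDyck_ofHt {n : ℕ} {f : ℕ → ℤ} (hf : DyckHt n f) : IsDyck (ofHt n f) := by
  rw [isDyck_iff, length_ofHt, ht_ofHt hf]
  exact hf

theorem ofHt_ht (P : BinPath) (hP : IsDyck P) : ofHt P.length (ht P) = P :=
  eq_of_ht_eq (length_ofHt _ _) (ht_ofHt ((isDyck_iff P).1 hP))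

theorem isValley_iff (P : BinPath) (i : ℕ) :
    isValley P i ↔ i < P.length ∧ ht P i = ht P (i + 1) + 1 ∧
      (i + 1 = P.length ∨ i + 1 < P.length ∧ ht P (i + 2) = ht P (i + 1) + 1) := by
  unfold isValley
  refine and_congr_right fun hi => ?_
  have h1 := ht_succ P i hi
  refine and_congr ?_ ?_
  · rw [h1]
    cases P.getD i true <;> simp
    omega
  · rcases Nat.lt_or_ge (i + 1) P.length with h | h
    · rw [ht_succ P (i + 1) h]
      cases P.getD (i + 1) true <;> simp <;> omega
    · have h' : i + 1 = P.length := by omega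
      simp [List.getD, h']

/-- A path lying weakly below another one at all its valleys of height at most `M` does so at all
its points of height at most `M`. -/
theorem DyckHt.le_of_le_at_valleys {n : ℕ} {f g : ℕ → ℤ} (hf : DyckHt n f) (hg : DyckHt n g)
    (M : ℤ) (h : ∀ k, InnerValley n f k → f k ≤ M → g k ≤ f k) :
    ∀ k, f k ≤ M → g k ≤ f k := by
  have key : ∀ (T : ℕ) (k : ℕ), f k = T → f k ≤ M → g k ≤ f k := by
    intro T
    induction T with
    | zero =>
      intro k hk hM
      rcases Nat.eq_zero_or_pos k with rfl | h0
      · rw [hf.zero, hg.zero]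
      rcases Nat.lt_or_ge k n with hn | hn
      · refine h k ⟨h0, hn, ?_, ?_⟩ hM
        · have h1 := hf.step (k - 1) (by omega)
          rw [Nat.sub_add_cancel h0] at h1
          have := hf.nonneg (k - 1)
          omega
        · have h1 := hf.step k hn
          have := hf.nonneg (k + 1)
          omega
      · rw [hf.tail k hn, hg.tail k hn]
    | succ T ih =>
      intro k hk hM
      rcases Nat.eq_zero_or_pos k with rfl | h0
      · rw [hf.zero, hg.zero]
      rcases Nat.lt_or_ge k n with hn | hn
      · have hl := hf.step (k - 1) (by omega)
        have hr := hf.step k hn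
        have gl := hg.step (k - 1) (by omega)
        have gr := hg.step k hn
        rw [Nat.sub_add_cancel h0] at hl gl
        have il := ih (k - 1)
        have ir := ih (k + 1)
        rcases hl with hl | hl
        · have := il (by push_cast at hk; omega) (by omega)
          omega
        rcases hr with hr | hr
        · exact h k ⟨h0, hn, by omega, hr⟩ hM
        · have := ir (by push_cast at hk; omega) (by omega)
          omega
      · rw [hf.tail k hn, hg.tail k hn]
  intro k
  have := hf.nonneg k
  exact key (f k).toNat k (by omega)

theorem sameValleysUpTo_iff {n : ℕ} {P Q : BinPath} (hP : IsDyck P) (hQ : IsDyck Q)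
    (hPn : P.length = n) (hQn : Q.length = n) (m : ℤ) :
    sameValleysUpTo P Q m ↔ ∀ k, min (ht P k) (m + 1) = min (ht Q k) (m + 1) := by
  have hf := (isDyck_iff P).1 hP
  have hg := (isDyck_iff Q).1 hQ
  unfold sameValleysUpTo
  simp only [isValley_iff]
  rw [hPn] at hf ⊢
  rw [hQn] at hg ⊢
  generalize ht P = f at *
  generalize ht Q = g at *
  constructor
  · intro h
    have h1 : ∀ k, f k ≤ m → g k ≤ f k := by
      refine hf.le_of_le_at_valleys hg m fun k hk hM => ?_
      obtain ⟨h0, hn, hl, hr⟩ := hk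
      obtain ⟨k, rfl⟩ : ∃ j, k = j + 1 := ⟨k - 1, by omega⟩
      have := (h k _ hM).1 ⟨⟨by omega, hl, Or.inr ⟨hn, hr⟩⟩, rfl⟩
      exact this.2.le
    have h2 : ∀ k, g k ≤ m → f k ≤ g k := by
      refine hg.le_of_le_at_valleys hf m fun k hk hM => ?_
      obtain ⟨h0, hn, hl, hr⟩ := hk
      obtain ⟨k, rfl⟩ : ∃ j, k = j + 1 := ⟨k - 1, by omega⟩
      have := (h k _ hM).2 ⟨⟨by omega, hl, Or.inr ⟨hn, hr⟩⟩, rfl⟩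
      exact this.2.le
    intro k
    have := h1 k
    have := h2 k
    omega
  · intro h i t ht
    have e0 := h i
    have e1 := h (i + 1)
    have e2 := h (i + 2)
    have fn := hf.tail n le_rfl
    have gn := hg.tail n le_rfl
    have f0 := hf.step i
    have f1 := hf.step (i + 1)
    have g0 := hg.step i
    have g1 := hg.step (i + 1)
    have fp := hf.nonneg i
    have gp := hg.nonneg i
    rw [show i + 1 + 1 = i + 2 from rfl] at f1 g1
    constructor
    · rintro ⟨⟨hi, hl, hr⟩, hv⟩
      have hg' : g (i + 1) = t := by omega
      refine ⟨⟨hi, ?_, ?_⟩, hg'⟩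
      · have := g0 hi
        omega
      · rcases hr with hr | ⟨hr, hr'⟩
        · exact Or.inl hr
        · have := g1 hr
          omega
    · rintro ⟨⟨hi, hl, hr⟩, hv⟩
      have hg' : f (i + 1) = t := by omega
      refine ⟨⟨hi, ?_, ?_⟩, hg'⟩
      · have := f0 hi
        omega
      · rcases hr with hr | ⟨hr, hr'⟩
        · exact Or.inl hr
        · have := f1 hr
          omega

theorem DyckHt.le_length {n : ℕ} {f : ℕ → ℤ} (hf : DyckHt n f) (k : ℕ) : f k ≤ n := by
  have key : ∀ k ≤ n, f k ≤ k := by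
    intro k
    induction k with
    | zero => intro _; simp [hf.zero]
    | succ k ih =>
      intro hk
      have := ih (by omega)
      have := hf.step k (by omega)
      push_cast
      omega
  rcases le_total k n with h | h
  · have := key k h
    omega
  · rw [hf.tail k h]
    omega

theorem le_hvNat {a : BinPath} (ha : IsDyck a) {k : ℕ} (hk : InnerValley a.length (ht a) k) :
    ht a k ≤ hvNat a := by
  obtain ⟨h0, hn, hl, hr⟩ := hk
  obtain ⟨k, rfl⟩ : ∃ j, k = j + 1 := ⟨k - 1, by omega⟩
  have : ht a (k + 1) ≤ hv a := by
    refine le_csSup ⟨a.length, ?_⟩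
      ⟨k, (isValley_iff a k).2 ⟨by omega, hl, Or.inr ⟨hn, hr⟩⟩, rfl⟩
    rintro _ ⟨i, -, rfl⟩
    exact ((isDyck_iff a).1 ha).le_length _
  unfold hvNat
  omega

/-- A decreasing sequence of height functions of Dyck paths of length `n` from `g` down to `f`
(eventually), whose `m`-th and `(m+1)`-st members agree when truncated at height `m + e`. -/
structure RevChain (n : ℕ) (e : ℕ) (f g : ℕ → ℤ) (c : ℕ → ℕ → ℤ) : Prop where
  zero : c 0 = g
  dyck : ∀ m, DyckHt n (c m)
  anti : ∀ m k, c (m + 1) k ≤ c m k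
  trunc : ∀ m k, min (c (m + 1) k) ((m : ℤ) + e) = min (c m k) ((m : ℤ) + e)
  eventually : ∃ M, ∀ m, M ≤ m → c m = f

namespace RevChain

variable {n e : ℕ} {f g : ℕ → ℤ} {c : ℕ → ℕ → ℤ}

theorem antitone (hc : RevChain n e f g c) (m d k : ℕ) : c (m + d) k ≤ c m k := by
  induction d with
  | zero => exact le_rfl
  | succ d ih => exact (hc.anti (m + d) k).trans ih

theorem le (hc : RevChain n e f g c) (m k : ℕ) : f k ≤ c m k := by
  obtain ⟨M, hM⟩ := hc.eventually
  rw [← hM (m + M) (by omega)]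
  exact hc.antitone m M k

theorem le_right (hc : RevChain n e f g c) (m k : ℕ) : c m k ≤ g k := by
  have := hc.antitone 0 m k
  rwa [hc.zero, Nat.zero_add] at this

theorem min_eq (hc : RevChain n e f g c) (m k : ℕ) :
    min (c m k) ((m : ℤ) + e) = min (f k) ((m : ℤ) + e) := by
  obtain ⟨M, hM⟩ := hc.eventually
  have key : ∀ d, min (c (m + d) k) ((m : ℤ) + e) = min (c m k) ((m : ℤ) + e) := by
    intro d
    induction d with
    | zero => rfl
    | succ d ih =>
      have := hc.trunc (m + d) k
      rw [← Nat.add_assoc]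
      push_cast at this
      omega
  rw [← key M, hM (m + M) (by omega)]

theorem eq_of_le (hc : RevChain n 1 f g c) (h : ℕ) (hh : ∀ k, InnerValley n f k → f k ≤ h)
    (m : ℕ) (hm : h ≤ m) : c m = f := by
  obtain ⟨M, hM⟩ := hc.eventually
  have hf : DyckHt n f := hM M le_rfl ▸ hc.dyck M
  funext k
  refine le_antisymm (hf.le_of_le_at_valleys (hc.dyck m) (f k) (fun j hj _ => ?_) k le_rfl)
    (hc.le m k)
  have h1 := hc.min_eq m j
  have h2 := hh j hj
  push_cast at h1
  omega

theorem eq_of_length_lt (hc : RevChain n e f g c) (m : ℕ) (hm : n < m) : c m = f := by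
  obtain ⟨M, hM⟩ := hc.eventually
  have hf : DyckHt n f := hM M le_rfl ▸ hc.dyck M
  funext k
  have h1 := hc.min_eq m k
  have h2 := hf.le_length k
  have h3 := (hc.dyck m).le_length k
  omega

end RevChain

theorem finite_dyckHt (n : ℕ) : {f : ℕ → ℤ | DyckHt n f}.Finite := by
  refine ((List.finite_length_eq Bool n).image ht).subset fun f hf => ?_
  exact ⟨ofHt n f, length_ofHt n f, ht_ofHt hf⟩

theorem finite_revChain (n e : ℕ) (f g : ℕ → ℤ) : {c | RevChain n e f g c}.Finite := by
  refine Set.Finite.of_finite_image (f := fun c (i : Fin (n + 1)) => c i.1)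
    ((Set.Finite.pi fun _ : Fin (n + 1) => finite_dyckHt n).subset ?_) ?_
  · rintro _ ⟨c, hc, rfl⟩ i -
    exact hc.dyck i
  · intro c hc c' hc' h
    funext m
    rcases Nat.lt_or_ge n m with hm | hm
    · rw [RevChain.eq_of_length_lt hc m hm, RevChain.eq_of_length_lt hc' m hm]
    · exact congrFun h ⟨m, by omega⟩

theorem ncard_eq_of_inverse {α β : Type*} {s : Set α} {t : Set β} (F : α → β) (G : β → α)
    (hF : ∀ x ∈ s, F x ∈ t) (hG : ∀ y ∈ t, G y ∈ s) (hGF : ∀ x ∈ s, G (F x) = x)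
    (hFG : ∀ y ∈ t, F (G y) = y) : s.ncard = t.ncard := by
  refine Set.ncard_congr (fun x _ => F x) hF (fun x y hx hy h => ?_)
    fun y hy => ⟨G y, hG y hy, hFG y hy⟩
  rw [← hGF x hx, ← hGF y hy, h]

theorem IsVChain.length_eq {a s : BinPath} {σ : ℕ → BinPath} (h : IsVChain a s σ)
    (hlen : a.length = s.length) (j : ℕ) : (σ j).length = a.length := by
  obtain ⟨h0, h1, -, h3, -⟩ := h
  rcases Nat.lt_or_ge j (hvNat a) with hj | hj
  · induction j with
    | zero => rw [h0]
    | succ j ih => rw [← (h3 j (by omega)).1, ih (by omega)]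
  · rw [h1 j hj, hlen]

theorem VPath_eq_ncard_revChain {a s : BinPath} (ha : IsDyck a) (hs : IsDyck s)
    (hlen : a.length = s.length) :
    VPath a s = Set.ncard {c | RevChain a.length 1 (ht a) (ht s) c} := by
  unfold VPath
  have stab : ∀ c, RevChain a.length 1 (ht a) (ht s) c → ∀ m, hvNat a ≤ m → c m = ht a :=
    fun c hc => hc.eq_of_le _ fun k hk => le_hvNat ha hk
  refine ncard_eq_of_inverse (fun σ m => ht (σ (hvNat a - m)))
    (fun c j => ofHt a.length (c (hvNat a - j))) ?_ ?_ ?_ ?_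
  · intro σ hσ
    have hl := hσ.length_eq hlen
    obtain ⟨h0, h1, h2, h3, h4⟩ := hσ
    refine ⟨?_, fun m => ?_, fun m k => ?_, fun m k => ?_, hvNat a, fun m hm => ?_⟩
    · simp [h1]
    · have := (isDyck_iff _).1 (h2 (hvNat a - m))
      rwa [hl] at this
    · rcases Nat.lt_or_ge m (hvNat a) with hm | hm
      · have := (h3 (hvNat a - (m + 1)) (by omega)).2 k
        rwa [show hvNat a - (m + 1) + 1 = hvNat a - m by omega] at this
      · simp [Nat.sub_eq_zero_of_le hm, Nat.sub_eq_zero_of_le (Nat.le_succ_of_le hm)]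
    · rcases Nat.lt_or_ge m (hvNat a) with hm | hm
      · have := (sameValleysUpTo_iff (h2 _) (h2 _) (hl _) (hl _) _).1
          (h4 (hvNat a - m) (by omega) (by omega)) k
        rw [show hvNat a - m - 1 = hvNat a - (m + 1) by omega,
          show (hvNat a : ℤ) - ((hvNat a - m : ℕ) : ℤ) = m by omega] at this
        exact_mod_cast this
      · simp [Nat.sub_eq_zero_of_le hm, Nat.sub_eq_zero_of_le (Nat.le_succ_of_le hm)]
    · simp [Nat.sub_eq_zero_of_le hm, h0]
  · intro c hc
    have hD := fun m => ht_ofHt (hc.dyck m)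
    refine ⟨?_, fun j hj => ?_, fun j => isDyck_ofHt (hc.dyck _), fun j hj => ?_,
      fun j hj hj' => ?_⟩
    · simp only [Nat.sub_zero]
      rw [stab c hc _ le_rfl, ofHt_ht a ha]
    · simp only [Nat.sub_eq_zero_of_le hj]
      rw [hc.zero, hlen, ofHt_ht s hs]
    · refine ⟨by simp [length_ofHt], fun k => ?_⟩
      rw [hD, hD]
      have := hc.anti (hvNat a - (j + 1)) k
      rwa [show hvNat a - (j + 1) + 1 = hvNat a - j by omega] at this
    · rw [sameValleysUpTo_iff (isDyck_ofHt (hc.dyck _)) (isDyck_ofHt (hc.dyck _))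
        (length_ofHt _ _) (length_ofHt _ _)]
      intro k
      rw [hD, hD]
      have := hc.trunc (hvNat a - j) k
      rw [show hvNat a - j + 1 = hvNat a - (j - 1) by omega,
        show ((hvNat a - j : ℕ) : ℤ) = hvNat a - j by omega] at this
      exact_mod_cast this
  · intro σ hσ
    have hl := hσ.length_eq hlen
    obtain ⟨h0, h1, h2, h3, h4⟩ := hσ
    funext j
    have e : σ (hvNat a - (hvNat a - j)) = σ j := by
      rcases Nat.lt_or_ge j (hvNat a) with hj | hj
      · rw [Nat.sub_sub_self hj.le]
      · rw [Nat.sub_eq_zero_of_le hj, h1 j hj, Nat.sub_zero, h1 _ le_rfl]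
    simp only [e]
    rw [← hl j, ofHt_ht _ (h2 j)]
  · intro c hc
    funext m
    simp only
    rw [ht_ofHt (hc.dyck _)]
    rcases Nat.lt_or_ge m (hvNat a) with hm | hm
    · rw [Nat.sub_sub_self hm.le]
    · rw [Nat.sub_eq_zero_of_le hm, stab c hc m hm, Nat.sub_zero, stab c hc _ le_rfl]

/-- The height function of `uPd`, where `f` is the height function of the path `P` of length `n`. -/
def liftHt (n : ℕ) (f : ℕ → ℤ) (k : ℕ) : ℤ :=
  if k = 0 then 0 else if k ≤ n + 1 then f (k - 1) + 1 else 0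

theorem liftHt_succ (n : ℕ) (f : ℕ → ℤ) (k : ℕ) :
    liftHt n f (k + 1) = if k ≤ n then f k + 1 else 0 := by
  simp [liftHt]

theorem dyckHt_liftHt {n : ℕ} {f : ℕ → ℤ} (hf : DyckHt n f) : DyckHt (n + 2) (liftHt n f) := by
  refine ⟨rfl, fun k hk => ?_, fun k hk => ?_, fun k => ?_⟩
  · rcases Nat.eq_zero_or_pos k with rfl | h0
    · simp [liftHt, hf.zero]
    obtain ⟨k, rfl⟩ : ∃ j, k = j + 1 := ⟨k - 1, by omega⟩
    have h1 := hf.step k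
    have h2 := hf.tail k
    simp only [liftHt_succ]
    split_ifs <;> omega
  · simp only [liftHt]
    split_ifs <;> omega
  · have := hf.nonneg (k - 1)
    simp only [liftHt]
    split_ifs <;> omega

theorem ht_lift (a : BinPath) (ha : IsDyck a) :
    ht (true :: (a ++ [false])) = liftHt a.length (ht a) := by
  have hf := (isDyck_iff a).1 ha
  have e1 : ∀ k ≤ a.length, ht (true :: (a ++ [false])) (k + 1) = ht a k + 1 := by
    intro k hk
    unfold ht
    rw [List.take_succ_cons, List.take_append_of_le_length hk]
    simp [add_comm]
  have e2 : ∀ k, a.length + 2 ≤ k → ht (true :: (a ++ [false])) k = 0 := by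
    intro k hk
    have := ht_succ (true :: (a ++ [false])) (a.length + 1) (by simp)
    rw [e1 _ le_rfl, ha.1] at this
    rw [ht_of_length_le _ _ (by simp; omega)]
    simpa using this
  funext k
  unfold liftHt
  split_ifs with h h'
  · rw [h, ht_zero]
  · obtain ⟨k, rfl⟩ : ∃ j, k = j + 1 := ⟨k - 1, by omega⟩
    exact e1 k (by omega)
  · exact e2 k (by omega)

theorem isDyck_lift {a : BinPath} (ha : IsDyck a) : IsDyck (true :: (a ++ [false])) := by
  rw [isDyck_iff, ht_lift a ha]
  simpa using dyckHt_liftHt ((isDyck_iff a).1 ha)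

/-- Inverse operation to `liftHt`. -/
def dropHt (n : ℕ) (f : ℕ → ℤ) (k : ℕ) : ℤ :=
  if k ≤ n then f (k + 1) - 1 else 0

theorem dropHt_liftHt {n : ℕ} {f : ℕ → ℤ} (hf : DyckHt n f) : dropHt n (liftHt n f) = f := by
  funext k
  have := hf.tail k
  simp only [dropHt, liftHt_succ]
  split_ifs <;> omega

theorem liftHt_dropHt {n : ℕ} {f : ℕ → ℤ} (hf : DyckHt (n + 2) f) :
    liftHt n (dropHt n f) = f := by
  funext k
  rcases Nat.eq_zero_or_pos k with rfl | h0
  · simp [liftHt, hf.zero]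
  obtain ⟨k, rfl⟩ : ∃ j, k = j + 1 := ⟨k - 1, by omega⟩
  have := hf.tail (k + 1)
  simp only [dropHt, liftHt_succ]
  split_ifs <;> omega

theorem ncard_revChain_liftHt {n : ℕ} {f g : ℕ → ℤ} (hf : DyckHt n f) (hg : DyckHt n g) :
    Set.ncard {c | RevChain (n + 2) 1 (liftHt n f) (liftHt n g) c}
      = Set.ncard {c | RevChain n 0 f g c} := by
  refine ncard_eq_of_inverse (fun c m => dropHt n (c m)) (fun c m => liftHt n (c m)) ?_ ?_ ?_ ?_
  · intro c hc
    refine ⟨?_, fun m => ?_, fun m k => ?_, fun m k => ?_, ?_⟩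
    · simp only [hc.zero, dropHt_liftHt hg]
    · have hD := hc.dyck m
      have hpos : ∀ k ≤ n, 1 ≤ c m (k + 1) := by
        intro k hk
        have h1 := hc.min_eq m (k + 1)
        have h2 := hf.nonneg k
        rw [liftHt_succ, if_pos hk] at h1
        push_cast at h1
        omega
      have hN := hD.tail (n + 2) le_rfl
      have hN' := hD.step (n + 1) (by omega)
      rw [show n + 1 + 1 = n + 2 from rfl] at hN'
      have hN'' := hD.nonneg (n + 1)
      refine ⟨?_, fun k hk => ?_, fun k hk => ?_, fun k => ?_⟩
      · have h1 := hD.step 0 (by omega)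
        have h2 := hpos 0 (by omega)
        have h3 := hD.zero
        simp only [dropHt, Nat.zero_le, if_true]
        simp only [Nat.zero_add] at *
        omega
      · have := hD.step (k + 1) (by omega)
        simp only [dropHt]
        split_ifs <;> omega
      · simp only [dropHt]
        split_ifs with h
        · obtain rfl : k = n := by omega
          omega
        · rfl
      · have := hpos k
        simp only [dropHt]
        split_ifs <;> omega
    · have := hc.anti m (k + 1)
      simp only [dropHt]
      split_ifs <;> omega
    · have := hc.trunc m (k + 1)
      simp only [dropHt]
      split_ifs
      · push_cast at this ⊢
        omega
      · rfl
    · obtain ⟨M, hM⟩ := hc.eventually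
      exact ⟨M, fun m hm => by simp only [hM m hm, dropHt_liftHt hf]⟩
  · intro c hc
    refine ⟨?_, fun m => dyckHt_liftHt (hc.dyck m), fun m k => ?_, fun m k => ?_, ?_⟩
    · simp only [hc.zero]
    · have := hc.anti m (k - 1)
      simp only [liftHt]
      split_ifs <;> omega
    · have := hc.trunc m (k - 1)
      simp only [liftHt]
      split_ifs
      · rfl
      · push_cast at this ⊢
        omega
      · rfl
    · obtain ⟨M, hM⟩ := hc.eventually
      exact ⟨M, fun m hm => by simp only [hM m hm]⟩
  · intro c hc
    funext m
    exact liftHt_dropHt (hc.dyck m)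
  · intro c hc
    funext m
    exact dropHt_liftHt (hc.dyck m)

/-- `w` arises from `f` by raising some of its interior valleys. -/
def Raises (n : ℕ) (f w : ℕ → ℤ) : Prop :=
  ∀ k, w k = f k ∨ InnerValley n f k ∧ w k = f k + 2

theorem DyckHt.parity {n : ℕ} {f g : ℕ → ℤ} (hf : DyckHt n f) (hg : DyckHt n g) (k : ℕ) :
    (g k - f k) % 2 = 0 := by
  induction k with
  | zero => simp [hf.zero, hg.zero]
  | succ k ih =>
    rcases Nat.lt_or_ge k n with h | h
    · have := hf.step k h
      have := hg.step k h
      omega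
    · simp [hf.tail (k + 1) (by omega), hg.tail (k + 1) (by omega)]

/-- Every point which is not an interior valley and has positive height has a lower neighbour. -/
theorem DyckHt.exists_lower {n : ℕ} {f : ℕ → ℤ} (hf : DyckHt n f) {k : ℕ}
    (hv : ¬ InnerValley n f k) (hk : 0 < f k) :
    0 < k ∧ k < n ∧ (f (k - 1) = f k - 1 ∨ f (k + 1) = f k - 1) := by
  have h0 : 0 < k := Nat.pos_of_ne_zero fun h => by rw [h, hf.zero] at hk; omega
  have hn : k < n := by
    by_contra h
    rw [hf.tail k (by omega)] at hk
    omega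
  have hl := hf.step (k - 1) (by omega)
  rw [Nat.sub_add_cancel h0] at hl
  have hr := hf.step k hn
  unfold InnerValley at hv
  omega

/-- Neighbours of an interior valley are not interior valleys. -/
theorem InnerValley.raises_neighbours {n : ℕ} {f w : ℕ → ℤ} {k : ℕ} (hk : InnerValley n f k)
    (hw : Raises n f w) : w (k - 1) = f k + 1 ∧ w (k + 1) = f k + 1 := by
  obtain ⟨h0, hn, hl, hr⟩ := hk
  constructor
  · rcases hw (k - 1) with h | ⟨⟨-, -, -, h⟩, -⟩
    · omega
    · rw [Nat.sub_add_cancel h0] at h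
      omega
  · rcases hw (k + 1) with h | ⟨⟨-, -, h, -⟩, -⟩
    · omega
    · rw [Nat.add_sub_cancel] at h
      omega

theorem Raises.dyckHt {n : ℕ} {f w : ℕ → ℤ} (hf : DyckHt n f) (hw : Raises n f w) :
    DyckHt n w := by
  refine ⟨?_, fun k hk => ?_, fun k hk => ?_, fun k => ?_⟩
  · rcases hw 0 with h | ⟨h, -⟩
    · rw [h, hf.zero]
    · exact absurd h.1 (lt_irrefl 0)
  · rcases hw k with h | ⟨hv, h⟩
    · rcases hw (k + 1) with h' | ⟨hv', h'⟩
      · rw [h, h']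
        exact hf.step k hk
      · have := (hv'.raises_neighbours hw).1
        rw [Nat.add_sub_cancel] at this
        omega
    · have := (hv.raises_neighbours hw).2
      omega
  · rcases hw k with h | ⟨h, -⟩
    · rw [h, hf.tail k hk]
    · exact absurd h.2.1 (by omega)
  · have := hf.nonneg k
    rcases hw k with h | ⟨-, h⟩ <;> omega

theorem Raises.le {n : ℕ} {f w : ℕ → ℤ} (hw : Raises n f w) (k : ℕ) : f k ≤ w k := by
  rcases hw k with h | ⟨-, h⟩ <;> omega

theorem length_starFill (a : BinPath) : (starFill a).length = a.length := by simp [starFill]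

open Classical in
theorem ht_starFill {a : BinPath} (ha : IsDyck a) (k : ℕ) :
    ht (starFill a) k = ht a k + if InnerValley a.length (ht a) k then 2 else 0 := by
  have hf := (isDyck_iff a).1 ha
  have key : ∀ k ≤ a.length,
      ht (starFill a) k = ht a k + if InnerValley a.length (ht a) k then 2 else 0 := by
    intro k
    induction k with
    | zero => intro _; simp [ht_zero, InnerValley]
    | succ k ih =>
      intro hk
      have hk' : k < a.length := hk
      rw [ht_succ _ k (by rw [length_starFill]; omega), ih (by omega)]
      have e : (starFill a).getD k true =
          if k + 1 = a.length ∧ a.getD k true = false then false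
          else if a.getD k true then a.getD (k - 1) true else a.getD (k + 1) true := by
        simp [starFill, List.getD, hk']
      rw [e]
      have s0 := ht_succ a k hk'
      have s1 := ht_succ a (k + 1)
      have s2 := ht_succ a (k - 1) (by omega)
      unfold InnerValley
      simp only [Nat.add_sub_cancel]
      rcases Nat.eq_zero_or_pos k with rfl | h0
      · cases h1 : a.getD 0 true <;> cases h2 : a.getD 1 true <;>
          simp only [h1, h2, Nat.zero_add, Nat.zero_sub] at * <;> grind
      · rw [Nat.sub_add_cancel h0] at s2
        cases h1 : a.getD k true <;> cases h2 : a.getD (k + 1) true <;>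
          cases h3 : a.getD (k - 1) true <;> simp only [h1, h2, h3] at * <;> grind
  rcases le_total k a.length with h | h
  · exact key k h
  · rw [ht_of_length_le _ k (by rwa [length_starFill]), length_starFill, key _ le_rfl,
      hf.tail k h, hf.tail _ le_rfl]
    rw [if_neg fun hv => absurd hv.2.1 (by omega), if_neg fun hv => absurd hv.2.1 (by omega)]

theorem mem_interval_starFill_iff {a : BinPath} (ha : IsDyck a) (w : BinPath) :
    (IsDyck w ∧ pathLe a w ∧ pathLe w (starFill a)) ↔
      w.length = a.length ∧ Raises a.length (ht a) (ht w) := by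
  have hf := (isDyck_iff a).1 ha
  constructor
  · rintro ⟨hw, ⟨hl, h1⟩, -, h2⟩
    have hg := (isDyck_iff w).1 hw
    rw [← hl] at hg
    refine ⟨hl.symm, fun k => ?_⟩
    have := h1 k
    have h2 := h2 k
    rw [ht_starFill ha] at h2
    have := hf.parity hg k
    split_ifs at h2 with h
    · rcases eq_or_ne (ht w k) (ht a k) with h' | h'
      · exact Or.inl h'
      · exact Or.inr ⟨h, by omega⟩
    · exact Or.inl (by omega)
  · rintro ⟨hl, hw⟩
    refine ⟨?_, ⟨hl.symm, hw.le⟩, by rw [length_starFill, hl], fun k => ?_⟩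
    · rw [isDyck_iff, hl]
      exact hw.dyckHt hf
    · rw [ht_starFill ha]
      rcases hw k with h | ⟨hv, h⟩
      · split_ifs <;> omega
      · rw [if_pos hv, h]

open Classical in
/-- Raise exactly those interior valleys of `f` which have been removed from `b m`, where `m` is
the height of the valley. -/
noncomputable def raiseOf (n : ℕ) (f : ℕ → ℤ) (b : ℕ → ℕ → ℤ) (k : ℕ) : ℤ :=
  if InnerValley n f k ∧ f k < b (f k).toNat k then f k + 2 else f k

theorem raises_raiseOf (n : ℕ) (f : ℕ → ℤ) (b : ℕ → ℕ → ℤ) : Raises n f (raiseOf n f b) := by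
  intro k
  unfold raiseOf
  split_ifs with h
  · exact Or.inr ⟨h.1, rfl⟩
  · exact Or.inl rfl

section Bijection

variable {n : ℕ} {f g : ℕ → ℤ} {b c : ℕ → ℕ → ℤ} {w : ℕ → ℤ}

theorem raiseOf_le (hf : DyckHt n f) (hb : RevChain n 0 f g b) (m k : ℕ) (hm : (m : ℤ) ≤ f k) :
    raiseOf n f b k ≤ b m k := by
  unfold raiseOf
  split_ifs with h
  · have h1 := hb.antitone m ((f k).toNat - m) k
    rw [show m + ((f k).toNat - m) = (f k).toNat by omega] at h1
    have := hf.parity (hb.dyck m) k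
    omega
  · exact hb.le m k

theorem le_raiseOf (hf : DyckHt n f) (hb : RevChain n 0 f g b) (m k : ℕ)
    (hm : raiseOf n f b k ≤ m) : b m k ≤ raiseOf n f b k := by
  have hle := (raises_raiseOf n f b).le k
  have h0 := hb.min_eq m k
  push_cast at h0
  rcases lt_or_ge (f k) m with h | h
  · omega
  have hfm : f k = m := by omega
  by_cases hv : InnerValley n f k
  · by_contra hlt
    have : raiseOf n f b k = f k + 2 := by
      unfold raiseOf
      refine if_pos ⟨hv, ?_⟩
      rw [hfm, Int.toNat_natCast]
      omega
    omega
  · rcases Nat.eq_zero_or_pos m with rfl | hmp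
    · have h00 := hf.nonneg k
      rcases Nat.eq_zero_or_pos k with rfl | hk0
      · rw [(hb.dyck 0).zero]
        omega
      rcases Nat.lt_or_ge k n with hn | hn
      · exfalso
        refine hv ⟨hk0, hn, ?_, ?_⟩
        · have h1 := hf.step (k - 1) (by omega)
          rw [Nat.sub_add_cancel hk0] at h1
          have := hf.nonneg (k - 1)
          omega
        · have h1 := hf.step k hn
          have := hf.nonneg (k + 1)
          omega
      · rw [(hb.dyck 0).tail k hn]
        omega
    · obtain ⟨hk0, hn, h | h⟩ := hf.exists_lower hv (by omega)
      · have h1 := hb.min_eq m (k - 1)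
        have h2 := (hb.dyck m).step (k - 1) (by omega)
        rw [Nat.sub_add_cancel hk0] at h2
        push_cast at h1
        omega
      · have h1 := hb.min_eq m (k + 1)
        have h2 := (hb.dyck m).step k hn
        push_cast at h1
        omega

theorem DyckHt.max (hf : DyckHt n f) (hg : DyckHt n g) :
    DyckHt n (fun k => max (f k) (g k)) := by
  refine ⟨by simp [hf.zero, hg.zero], fun k hk => ?_, fun k hk => ?_, fun k => ?_⟩
  · have := hf.step k hk
    have := hg.step k hk
    have := hf.parity hg k
    omega
  · simp [hf.tail k hk, hg.tail k hk]
  · exact le_max_of_le_left (hf.nonneg k)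

theorem revChain_max_raiseOf (hf : DyckHt n f) (hb : RevChain n 0 f g b) :
    RevChain n 1 (raiseOf n f b) g (fun m k => max (b m k) (raiseOf n f b k)) := by
  have hw := raises_raiseOf n f b
  have key : ∀ m k, min (max (b m k) (raiseOf n f b k)) ((m : ℤ) + 1)
      = min (raiseOf n f b k) ((m : ℤ) + 1) := by
    intro m k
    have := le_raiseOf hf hb m k
    omega
  refine ⟨?_, fun m => (hb.dyck m).max (hw.dyckHt hf), fun m k => ?_, fun m k => ?_, ?_⟩
  · funext k
    have h1 := raiseOf_le hf hb 0 k (by simpa using hf.nonneg k)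
    rw [hb.zero] at *
    exact max_eq_left h1
  · exact max_le_max (hb.anti m k) le_rfl
  · have h1 := key m k
    have h2 := key (m + 1) k
    push_cast at h1 h2 ⊢
    omega
  · obtain ⟨M, hM⟩ := hb.eventually
    refine ⟨M, fun m hm => funext fun k => ?_⟩
    simp only [hM m hm]
    exact max_eq_right (hw.le k)

/-- Replace the points of each member `c m` above a point of `f` of height less than `m` by the
latter. -/
def restore (f : ℕ → ℤ) (c : ℕ → ℕ → ℤ) (m k : ℕ) : ℤ :=
  if f k < m then f k else c m k

theorem revChain_restore (hf : DyckHt n f) (hw : Raises n f w) (hc : RevChain n 1 w g c) :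
    RevChain n 0 f g (restore f c) := by
  have hle : ∀ m k, f k ≤ c m k := fun m k => (hw.le k).trans (hc.le m k)
  have hup : ∀ (m k : ℕ), f k = m → f (k + 1) = f k - 1 → c m k = m := by
    intro m k h1 h2
    have := hc.min_eq m k
    have hwk : w k = f k := by
      rcases hw k with h | ⟨⟨-, -, -, h⟩, -⟩ <;> omega
    push_cast at this
    omega
  have hdn : ∀ (m k : ℕ), f (k + 1) = m → f k = f (k + 1) - 1 → c m (k + 1) = m := by
    intro m k h1 h2
    have := hc.min_eq m (k + 1)
    have hwk : w (k + 1) = f (k + 1) := by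
      rcases hw (k + 1) with h | ⟨⟨-, -, h, -⟩, -⟩
      · exact h
      · rw [Nat.add_sub_cancel] at h
        omega
    push_cast at this
    omega
  refine ⟨?_, fun m => ⟨?_, fun k hk => ?_, fun k hk => ?_, fun k => ?_⟩, fun m k => ?_,
    fun m k => ?_, ?_⟩
  · funext k
    have := hf.nonneg k
    unfold restore
    rw [if_neg (by push_cast; omega), hc.zero]
  · unfold restore
    split_ifs
    · exact hf.zero
    · exact (hc.dyck m).zero
  · have h1 := hf.step k hk
    have h2 := (hc.dyck m).step k hk
    have h3 := hup m k
    have h4 := hdn m k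
    unfold restore
    split_ifs <;> omega
  · unfold restore
    rw [hf.tail k hk, (hc.dyck m).tail k hk, ite_self]
  · have := hf.nonneg k
    have := (hc.dyck m).nonneg k
    unfold restore
    split_ifs <;> omega
  · have := hc.anti m k
    have := hle m k
    unfold restore
    push_cast
    split_ifs <;> omega
  · have := hle m k
    have := hle (m + 1) k
    unfold restore
    push_cast
    split_ifs <;> omega
  · refine ⟨n + 1, fun m hm => funext fun k => ?_⟩
    have := hf.le_length k
    unfold restore
    rw [if_pos (by omega)]

theorem raiseOf_restore (hf : DyckHt n f) (hw : Raises n f w) (hc : RevChain n 1 w g c) :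
    raiseOf n f (restore f c) = w := by
  funext k
  have h0 := hf.nonneg k
  have h1 : restore f c (f k).toNat k = c (f k).toNat k := if_neg (by omega)
  have h2 := hc.min_eq (f k).toNat k
  push_cast at h2
  rw [Int.toNat_of_nonneg h0] at h2
  unfold raiseOf
  rw [h1]
  rcases hw k with h | ⟨hv, h⟩
  · rw [if_neg (by omega), h]
  · rw [if_pos ⟨hv, by omega⟩, h]

theorem max_restore (hw : Raises n f w) (hc : RevChain n 1 w g c) :
    (fun m k => max (restore f c m k) (w k)) = c := by
  funext m k
  have hle := hw.le k
  have h1 := hc.le m k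
  have h2 := hc.min_eq m k
  push_cast at h2
  unfold restore
  split_ifs with h
  · rcases hw k with hk | ⟨hv, hk⟩
    · omega
    · have h3 := (hv.raises_neighbours hw).2
      have h4 := hc.min_eq m (k + 1)
      have h5 := (hc.dyck m).step k hv.2.1
      push_cast at h4
      omega
  · omega

theorem restore_max (hf : DyckHt n f) (hb : RevChain n 0 f g b) :
    restore f (fun m k => max (b m k) (raiseOf n f b k)) = b := by
  funext m k
  have h1 := hb.min_eq m k
  have h2 := raiseOf_le hf hb m k
  push_cast at h1
  simp only [restore]
  split_ifs <;> omega

theorem ncard_fiber (hf : DyckHt n f) (hw : Raises n f w) :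
    Set.ncard {b | RevChain n 0 f g b ∧ raiseOf n f b = w} =
      Set.ncard {c | RevChain n 1 w g c} := by
  refine ncard_eq_of_inverse (fun b m k => max (b m k) (w k)) (restore f) ?_ ?_ ?_ ?_
  · rintro b ⟨hb, rfl⟩
    exact revChain_max_raiseOf hf hb
  · intro c hc
    exact ⟨revChain_restore hf hw hc, raiseOf_restore hf hw hc⟩
  · rintro b ⟨hb, rfl⟩
    exact restore_max hf hb
  · intro c hc
    exact max_restore hw hc

end Bijection

/-- For Dyck paths `a ≤ s` of the same length,
`V(uad, usd) = Σ_{w ∈ [a, a*]} V(w, s)`, summed over Dyck paths `w` in the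
interval `[a, a*]`. -/
theorem statement15 (a s : BinPath) (ha : IsDyck a) (hs : IsDyck s)
    (hlen : a.length = s.length) (hle : pathLe a s) :
    VPath (true :: (a ++ [false])) (true :: (s ++ [false]))
      = ∑ᶠ (w : BinPath) (_ : IsDyck w ∧ pathLe a w ∧ pathLe w (starFill a)),
          VPath w s := by
  have hf := (isDyck_iff a).1 ha
  have hg := (isDyck_iff s).1 hs
  rw [← hlen] at hg
  rw [VPath_eq_ncard_revChain (isDyck_lift ha) (isDyck_lift hs) (by simp [hlen]),
    ht_lift a ha, ht_lift s hs, ← hlen,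
    show (true :: (a ++ [false])).length = a.length + 2 by simp, ncard_revChain_liftHt hf hg]
  let S : Set BinPath := {w | IsDyck w ∧ pathLe a w ∧ pathLe w (starFill a)}
  let B : BinPath → Set (ℕ → ℕ → ℤ) := fun w =>
    {b | RevChain a.length 0 (ht a) (ht s) b ∧ raiseOf a.length (ht a) b = ht w}
  have hS : ∀ w, w ∈ S ↔ w.length = a.length ∧ Raises a.length (ht a) (ht w) :=
    mem_interval_starFill_iff ha
  have hunion : {b | RevChain a.length 0 (ht a) (ht s) b} = ⋃ w ∈ S, B w := by
    ext b
    simp only [Set.mem_iUnion, exists_prop]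
    constructor
    · intro hb
      have hr := raises_raiseOf a.length (ht a) b
      have e := ht_ofHt (hr.dyckHt hf)
      refine ⟨ofHt a.length (raiseOf a.length (ht a) b), (hS _).2 ⟨length_ofHt _ _, ?_⟩, hb, e.symm⟩
      rwa [e]
    · rintro ⟨w, -, hb, -⟩
      exact hb
  have hSfin : S.Finite :=
    (List.finite_length_eq Bool a.length).subset fun w hw => ((hS w).1 hw).1
  rw [hunion, hSfin.ncard_biUnion
    (fun w _ => (finite_revChain _ _ _ _).subset fun b hb => hb.1)]
  · refine finsum_mem_congr rfl fun w hw => ?_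
    obtain ⟨hl, hr⟩ := (hS w).1 hw
    rw [VPath_eq_ncard_revChain hw.1 hs (hl.trans hlen), hl]
    exact ncard_fiber hf hr
  · intro w hw w' hw' hne
    refine Set.disjoint_left.2 fun b hb hb' => hne ?_
    exact eq_of_ht_eq (((hS w).1 hw).1.trans ((hS w').1 hw').1.symm) (hb.2.symm.trans hb'.2)
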